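/- arXiv:1006.0474 — 3 statements merged into one kernel-verified Lean document; each statement's English description precedes it below -/
import Mathlib

section
/- Let G be a loopless graph, H a graph, and f, g : G → H graph homomorphisms. Then f ∼ g (i.e. (f(u), g(v)) ∈ E(H) for every edge (u, v) ∈ E(G)) if and only if every function h : V(G) → V(H) with h(u) ∈ {f(u), g(u)} for all u ∈ V(G) is a graph homomorphism G → H. -/
/-- Let `G` be a loopless graph, `H` a graph (given by a symmetric adjacency
relation `E`, possibly with loops), and `f, g : G → H` graph homomorphisms.
Then `f ∼ g` (i.e. `(f(u), g(v)) ∈ E(H)` for every edge `(u,v) ∈ E(G)`)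
iff every `h : V(G) → V(H)` with `h(u) ∈ {f(u), g(u)}` for all `u` is a graph
homomorphism. -/
theorem adj_iff_all_mixed_maps_are_homs {V W : Type*} (G : SimpleGraph V)
    (E : W → W → Prop) (hE : Symmetric E)
    (f g : V → W)
    (hf : ∀ u v, G.Adj u v → E (f u) (f v))
    (hg : ∀ u v, G.Adj u v → E (g u) (g v)) :
    (∀ u v, G.Adj u v → E (f u) (g v)) ↔
      (∀ h : V → W, (∀ u, h u = f u ∨ h u = g u) →
        ∀ u v, G.Adj u v → E (h u) (h v)) := by
  classical
  constructor
  · intro hfg h hh u v huv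
    rcases hh u with hu | hu <;> rcases hh v with hv | hv <;> rw [hu, hv]
    · exact hf u v huv
    · exact hfg u v huv
    · exact hE (hfg v u huv.symm)
    · exact hg u v huv
  · intro hmix u v huv
    have hE_uv := hmix (Function.update g u (f u))
      (fun w => by by_cases hw : w = u <;> simp [hw]) u v huv
    simpa [huv.ne'] using hE_uv
end

section
/- Let n ≥ 1, 0 ≤ i ≤ k, m = 2n + k. A vertex S of the semi-stable Kneser graph SḠ_{n,k} satisfies min S ≥ i if and only if S ⊆ {i, …, m−1}, and the map S ↦ S − i (subtracting i from each element) is an isomorphism from the induced subgraph of SḠ_{n,k} on the vertices S with min S ≥ i onto SḠ_{n,k−i}. Moreover this isomorphism transforms the restriction of the canonical colouring c_{n,k} into i + c_{n,k−i}. -/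
/-- For functions `f g : V(G) → V(H)`, `f ∼ g` iff `(f(u), g(v)) ∈ E(H)`
for every edge `(u,v) ∈ E(G)`. -/
def GraphMapsAdj {V W : Type*} (G : SimpleGraph V) (H : SimpleGraph W)
    (f g : V → W) : Prop :=
  ∀ ⦃u v : V⦄, G.Adj u v → H.Adj (f u) (g v)

/-- `f ≃ g` (×-homotopic): a finite chain `f = h₀ ∼ h₁ ∼ ⋯ ∼ h_N = g`
of graph homomorphisms. -/
def HomHomotopic {V W : Type*} (G : SimpleGraph V) (H : SimpleGraph W)
    (f g : G →g H) : Prop :=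
  Relation.ReflTransGen (fun a b : G →g H => GraphMapsAdj G H a b) f g

/-- `x` is the minimum element of the finset `S`. -/
def IsMinOf (S : Finset ℕ) (x : ℕ) : Prop := x ∈ S ∧ ∀ y ∈ S, x ≤ y

/-- `S ⊆ {0, …, m−1}` is semi-stable: `{i, i+1} ⊄ S` for all `0 ≤ i ≤ m−2`. -/
def SemiStable (m : ℕ) (S : Finset ℕ) : Prop :=
  S ⊆ Finset.range m ∧ ∀ i, i + 1 < m → ¬(i ∈ S ∧ i + 1 ∈ S)

/-- `S` is stable: semi-stable and additionally `{0, m−1} ⊄ S`. -/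
def StableSet (m : ℕ) (S : Finset ℕ) : Prop :=
  SemiStable m S ∧ ¬(0 ∈ S ∧ m - 1 ∈ S)

/-- Vertices of the stable Kneser graph: stable `n`-subsets of `{0, …, 2n+k−1}`. -/
abbrev SGVert (n k : ℕ) : Type := {S : Finset ℕ // S.card = n ∧ StableSet (2*n+k) S}

/-- Vertices of the semi-stable Kneser graph. -/
abbrev SSGVert (n k : ℕ) : Type := {S : Finset ℕ // S.card = n ∧ SemiStable (2*n+k) S}

/-- The stable Kneser graph `SG_{n,k}`: stable `n`-subsets of `{0, …, 2n+k−1}`,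
adjacent iff disjoint. -/
def SG (n k : ℕ) : SimpleGraph (SGVert n k) :=
  SimpleGraph.fromRel (fun S T => Disjoint S.1 T.1)

/-- The semi-stable Kneser graph `SḠ_{n,k}`. -/
def SSG (n k : ℕ) : SimpleGraph (SSGVert n k) :=
  SimpleGraph.fromRel (fun S T => Disjoint S.1 T.1)

theorem mem_image_sub_iff {S : Finset ℕ} {i : ℕ} (h : ∀ x ∈ S, i ≤ x) (y : ℕ) :
    y ∈ S.image (fun x => x - i) ↔ y + i ∈ S := by
  constructor
  · intro hy
    obtain ⟨x, hx, rfl⟩ := Finset.mem_image.1 hy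
    rwa [Nat.sub_add_cancel (h x hx)]
  · exact fun hy => Finset.mem_image.2 ⟨y + i, hy, Nat.add_sub_cancel y i⟩

theorem mem_image_add_iff {S : Finset ℕ} {i : ℕ} (y : ℕ) :
    y ∈ S.image (fun x => x + i) ↔ i ≤ y ∧ y - i ∈ S := by
  constructor
  · intro hy
    obtain ⟨x, hx, rfl⟩ := Finset.mem_image.1 hy
    exact ⟨Nat.le_add_left i x, by rwa [Nat.add_sub_cancel]⟩
  · exact fun ⟨hi, hy⟩ => Finset.mem_image.2 ⟨y - i, hy, Nat.sub_add_cancel hi⟩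

theorem card_image_sub {S : Finset ℕ} {i : ℕ} (h : ∀ x ∈ S, i ≤ x) :
    (S.image (fun x => x - i)).card = S.card :=
  Finset.card_image_of_injOn fun a ha b hb hab => by
    have := h a ha
    have := h b hb
    omega

theorem SemiStable.image_sub {m i : ℕ} {S : Finset ℕ} (hS : SemiStable m S)
    (h : ∀ x ∈ S, i ≤ x) : SemiStable (m - i) (S.image (fun x => x - i)) := by
  refine ⟨fun y hy => ?_, fun j hj hjj => ?_⟩
  · have := Finset.mem_range.1 (hS.1 ((mem_image_sub_iff h y).1 hy))
    exact Finset.mem_range.2 (by omega)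
  · rw [mem_image_sub_iff h, mem_image_sub_iff h, Nat.add_right_comm] at hjj
    exact hS.2 (j + i) (by omega) hjj

theorem SemiStable.image_add {m : ℕ} {S : Finset ℕ} (hS : SemiStable m S) (i : ℕ) :
    SemiStable (m + i) (S.image (fun x => x + i)) := by
  refine ⟨fun y hy => ?_, fun j hj hjj => ?_⟩
  · have hy := (mem_image_add_iff y).1 hy
    have := Finset.mem_range.1 (hS.1 hy.2)
    exact Finset.mem_range.2 (by omega)
  · rw [mem_image_add_iff, mem_image_add_iff] at hjj
    obtain ⟨⟨hi, h₁⟩, -, h₂⟩ := hjj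
    exact hS.2 (j - i) (by omega) ⟨h₁, by rwa [← Nat.sub_add_comm hi]⟩

theorem image_add_image_sub {S : Finset ℕ} {i : ℕ} (h : ∀ x ∈ S, i ≤ x) :
    (S.image (fun x => x - i)).image (fun x => x + i) = S := by
  ext y
  rw [mem_image_add_iff, mem_image_sub_iff h]
  exact ⟨fun ⟨hi, hy⟩ => by rwa [Nat.sub_add_cancel hi] at hy,
    fun hy => ⟨h y hy, by rwa [Nat.sub_add_cancel (h y hy)]⟩⟩

theorem image_sub_image_add (S : Finset ℕ) (i : ℕ) :
    (S.image (fun x => x + i)).image (fun x => x - i) = S := by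
  simp [Finset.image_image, Function.comp_def]

theorem disjoint_image_sub_iff {S T : Finset ℕ} {i : ℕ} (hS : ∀ x ∈ S, i ≤ x)
    (hT : ∀ x ∈ T, i ≤ x) :
    Disjoint (S.image (fun x => x - i)) (T.image (fun x => x - i)) ↔ Disjoint S T := by
  simp only [Finset.disjoint_left, mem_image_sub_iff hS, mem_image_sub_iff hT]
  refine ⟨fun h x hx => ?_, fun h y => @h (y + i)⟩
  simpa [Nat.sub_add_cancel (hS x hx), hx] using @h (x - i)

/-- Subtracting `i` identifies the vertices with minimum at least `i` with the vertices of
the semi-stable Kneser graph with parameter `k - i`. -/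
def shiftEquiv (n k i : ℕ) (hik : i ≤ k) :
    {S : SSGVert n k | ∀ x ∈ S.1, i ≤ x} ≃ SSGVert n (k - i) where
  toFun S := ⟨S.1.1.image (fun x => x - i), (card_image_sub S.2).trans S.1.2.1, by
    rw [← Nat.add_sub_assoc hik]
    exact S.1.2.2.image_sub S.2⟩
  invFun T := ⟨⟨T.1.image (fun x => x + i),
      (Finset.card_image_of_injective _ (add_left_injective i)).trans T.2.1, by
        have h := T.2.2.image_add i
        rwa [add_assoc, Nat.sub_add_cancel hik] at h⟩,
    fun y hy => ((mem_image_add_iff y).1 hy).1⟩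
  left_inv S := Subtype.ext (Subtype.ext (image_add_image_sub S.2))
  right_inv T := Subtype.ext (image_sub_image_add T.1 i)

/-- For `n ≥ 1`, `0 ≤ i ≤ k`, `m = 2n + k`: a vertex `S` of `SḠ_{n,k}` has
`min S ≥ i` iff `S ⊆ {i, …, m−1}`, and `S ↦ S − i` is an isomorphism from the
induced subgraph of `SḠ_{n,k}` on `{S : min S ≥ i}` onto `SḠ_{n,k−i}`.  Moreover
this isomorphism transforms the restriction of the canonical colouring `c_{n,k}`
into `i + c_{n,k−i}`: if `x = min S` and `y = min (S − i)` then `x = i + y`. -/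
theorem top_part_iso_semistable (n k i : ℕ) (hn : 1 ≤ n) (hik : i ≤ k) :
    (∀ S : SSGVert n k, ∀ x : ℕ, IsMinOf S.1 x →
      (i ≤ x ↔ S.1 ⊆ Finset.Icc i (2*n+k-1))) ∧
    ∃ φ : (SSG n k).induce {S : SSGVert n k | ∀ x ∈ S.1, i ≤ x} ≃g SSG n (k - i),
      (∀ S : {S : SSGVert n k // ∀ x ∈ S.1, i ≤ x},
        (φ S).1 = S.1.1.image (fun x => x - i)) ∧
      (∀ S : {S : SSGVert n k // ∀ x ∈ S.1, i ≤ x}, ∀ x y : ℕ,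
        IsMinOf S.1.1 x → IsMinOf (φ S).1 y → x = i + y) := by
  refine ⟨fun S x hx => ⟨fun hi y hy => ?_, fun h => (Finset.mem_Icc.1 (h hx.1)).1⟩,
    ⟨shiftEquiv n k i hik, fun {S T} => ?_⟩, fun S => rfl, fun S x y hx hy => ?_⟩
  · have := Finset.mem_range.1 (S.2.2.1 hy)
    have := hx.2 y hy
    exact Finset.mem_Icc.2 (by omega)
  · simp only [SSG, SimpleGraph.comap_adj, SimpleGraph.fromRel_adj, ne_eq,
      EmbeddingLike.apply_eq_iff_eq]
    exact and_congr Iff.rfl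
      (or_congr (disjoint_image_sub_iff S.2 T.2) (disjoint_image_sub_iff T.2 S.2))
  · have hmem (z : ℕ) := mem_image_sub_iff S.2 z
    have hxi := S.2 x hx.1
    have h₁ := hx.2 _ ((hmem y).1 hy.1)
    have h₂ := hy.2 (x - i) ((hmem _).2 (by rw [Nat.sub_add_cancel hxi]; exact hx.1))
    omega
end

section
/- Let n ≥ 1, k ≥ 1, m = 2n + k. The vertices S of SḠ_{n,k} with m−1 ∉ S are exactly the semi-stable n-element subsets of {0, …, m−2}, and the induced subgraph of SḠ_{n,k} on these vertices equals SḠ_{n,k−1}. Moreover, on this subgraph the map c' (defined by c'(S) = k+1 if m−1 ∈ S and c'(S) = min S otherwise) restricts to the canonical colouring c_{n,k−1}. -/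
theorem semiStable_succ_and_notMem_iff {m : ℕ} {S : Finset ℕ} :
    SemiStable (m + 1) S ∧ m ∉ S ↔ SemiStable m S := by
  simp only [SemiStable, Finset.subset_iff, Finset.mem_range]
  constructor
  · rintro ⟨⟨hsub, hS⟩, hm⟩
    exact ⟨fun x hx => by grind, fun i hi => hS i (by omega)⟩
  · rintro ⟨hsub, hS⟩
    exact ⟨⟨fun x hx => by grind, fun i _ h => hS i (hsub h.2) h⟩, fun h => by grind⟩

/-- For `n ≥ 1`, `k ≥ 1`, `m = 2n + k`: the vertices `S` of `SḠ_{n,k}` with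
`m−1 ∉ S` are exactly the semi-stable `n`-subsets of `{0, …, m−2}`, the induced
subgraph of `SḠ_{n,k}` on these vertices equals (is isomorphic, by the identity
on underlying sets, to) `SḠ_{n,k−1}`, and on this subgraph the map `c'`
(`c'(S) = k+1` if `m−1 ∈ S`, `c'(S) = min S` otherwise) restricts to the
canonical colouring `c_{n,k−1}`, i.e. `c'(S) = min S` there. -/
theorem bottom_part_eq_semistable (n k : ℕ) (hn : 1 ≤ n) (hk : 1 ≤ k) :
    (∀ S : Finset ℕ, S.card = n →
      ((SemiStable (2*n+k) S ∧ 2*n+k-1 ∉ S) ↔ SemiStable (2*n+(k-1)) S)) ∧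
    ∃ φ : (SSG n k).induce {S : SSGVert n k | 2*n+k-1 ∉ S.1} ≃g SSG n (k - 1),
      (∀ S : {S : SSGVert n k // 2*n+k-1 ∉ S.1}, (φ S).1 = S.1.1) ∧
      ∀ c' : SSGVert n k → ℕ,
        (∀ S : SSGVert n k,
          (2*n+k-1 ∈ S.1 → c' S = k + 1) ∧
          (2*n+k-1 ∉ S.1 → IsMinOf S.1 (c' S))) →
        ∀ S : {S : SSGVert n k // 2*n+k-1 ∉ S.1}, IsMinOf (φ S).1 (c' S.1) := by
  have key (S : Finset ℕ) :
      (SemiStable (2*n+k) S ∧ 2*n+k-1 ∉ S) ↔ SemiStable (2*n+(k-1)) S := by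
    obtain ⟨l, rfl⟩ := Nat.exists_eq_add_of_le' hk
    exact semiStable_succ_and_notMem_iff
  refine ⟨fun S _ => key S, ?_⟩
  let e : {S : SSGVert n k | 2*n+k-1 ∉ S.1} ≃ SSGVert n (k - 1) :=
    { toFun := fun S => ⟨S.1.1, S.1.2.1, (key S.1.1).1 ⟨S.1.2.2, S.2⟩⟩
      invFun := fun T =>
        ⟨⟨T.1, T.2.1, ((key T.1).2 T.2.2).1⟩, ((key T.1).2 T.2.2).2⟩
      left_inv := fun _ => rfl
      right_inv := fun _ => rfl }
  refine ⟨⟨e, ?_⟩, fun _ => rfl, fun c' hc' S => (hc' S.1).2 S.2⟩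
  intro S T
  simp [SSG, e, Subtype.ext_iff]
end
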